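/- arXiv:1505.04422 — 5 statements merged into one kernel-verified Lean document; each statement's English description precedes it below -/
import Mathlib

section
/- Let T : X → Y be a closed, densely defined linear operator between Hilbert spaces. If the quotient Y / closure(range T) is finite dimensional and range T has finite codimension in the sense that Y = range(T) + F for a finite-dimensional subspace F, then range(T) is closed in Y. -/
open scoped LinearPMap InnerProductSpace ComplexConjugate

noncomputable section

/-- The range of a partially defined linear map. -/
def LinearPMap.pRange {R E F : Type*} [Ring R] [AddCommGroup E] [Module R E]
    [AddCommGroup F] [Module R F] (T : E →ₗ.[R] F) : Submodule R F :=
  LinearMap.range T.toFun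

/-- The kernel of a partially defined linear map, viewed as a submodule of the ambient space. -/
def LinearPMap.pKer {R E F : Type*} [Ring R] [AddCommGroup E] [Module R E]
    [AddCommGroup F] [Module R F] (T : E →ₗ.[R] F) : Submodule R E :=
  (LinearMap.ker T.toFun).map T.domain.subtype

/-- A continuous linear map between Banach spaces has closed range as soon as its range and some
finite-dimensional subspace together span the codomain. -/
theorem ContinuousLinearMap.isClosed_range_of_sup_finiteDimensional_eq_top
    {𝕜 E Y : Type*} [NontriviallyNormedField 𝕜] [CompleteSpace 𝕜]
    [NormedAddCommGroup E] [NormedSpace 𝕜 E] [CompleteSpace E]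
    [NormedAddCommGroup Y] [NormedSpace 𝕜 Y] [CompleteSpace Y]
    (A : E →L[𝕜] Y) (F : Submodule 𝕜 Y) [FiniteDimensional 𝕜 F]
    (hsum : LinearMap.range (A : E →ₗ[𝕜] Y) ⊔ F = ⊤) :
    IsClosed (LinearMap.range (A : E →ₗ[𝕜] Y) : Set Y) := by
  have : CompleteSpace F := FiniteDimensional.complete 𝕜 F
  let B : E × F →L[𝕜] Y := A.coprod F.subtypeL
  have hB : Function.Surjective B := by
    intro y
    have hy : y ∈ LinearMap.range (A : E →ₗ[𝕜] Y) ⊔ F := hsum ▸ Submodule.mem_top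
    obtain ⟨_, ⟨x, rfl⟩, f, hf, rfl⟩ := Submodule.mem_sup.1 hy
    exact ⟨(x, ⟨f, hf⟩), by simp [B]⟩
  rw [← (B.isQuotientMap hB).isClosed_preimage]
  have hpre : B ⁻¹' (LinearMap.range (A : E →ₗ[𝕜] Y) : Set Y) =
      Prod.snd ⁻¹' ((LinearMap.range (A : E →ₗ[𝕜] Y)).comap F.subtype : Set F) := by
    ext ⟨x, f⟩
    exact Submodule.add_mem_iff_right _ (LinearMap.mem_range_self (A : E →ₗ[𝕜] Y) x)
  rw [hpre]
  exact (Submodule.closed_of_finiteDimensional _).preimage continuous_snd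

theorem LinearPMap.map_snd_graph {R E F : Type*} [Ring R] [AddCommGroup E] [Module R E]
    [AddCommGroup F] [Module R F] (T : E →ₗ.[R] F) :
    T.graph.map (LinearMap.snd R E F) = T.pRange := by
  ext y
  simp [LinearPMap.pRange, LinearPMap.mem_graph_iff]

/-- A closed densely defined operator between Hilbert spaces whose range has finite
codimension (and whose range-closure has finite-dimensional quotient) has closed range. -/
theorem statement0 {X Y : Type*}
    [NormedAddCommGroup X] [InnerProductSpace ℂ X] [CompleteSpace X]
    [NormedAddCommGroup Y] [InnerProductSpace ℂ Y] [CompleteSpace Y]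
    (T : X →ₗ.[ℂ] Y) (hclosed : T.IsClosed) (hdense : Dense (T.domain : Set X))
    (hfin : FiniteDimensional ℂ (Y ⧸ T.pRange.topologicalClosure))
    (F : Submodule ℂ Y) (hF : FiniteDimensional ℂ F) (hsum : T.pRange ⊔ F = ⊤) :
    IsClosed (T.pRange : Set Y) := by
  have : CompleteSpace T.graph := hclosed.completeSpace_coe
  let A : T.graph →L[ℂ] Y := (ContinuousLinearMap.snd ℂ X Y).comp T.graph.subtypeL
  have hA : LinearMap.range (A : T.graph →ₗ[ℂ] Y) = T.pRange :=
    (LinearMap.range_domRestrict T.graph (LinearMap.snd ℂ X Y)).trans T.map_snd_graph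
  rw [← hA] at hsum ⊢
  exact A.isClosed_range_of_sup_finiteDimensional_eq_top F hsum
end
end

section
/- Let A, B be closed densely defined operators on a Hilbert space H with B = A* (the adjoint of A), suppose A∘A = 0 in the sense that range(A) ⊆ ker(A), and suppose both range(A) and range(A*) are closed. Then H decomposes as the orthogonal direct sum H = (ker A ∩ ker A*) ⊕ range(A) ⊕ range(A*). -/
open scoped LinearPMap InnerProductSpace ComplexConjugate

noncomputable section

namespace LinearPMap

theorem mem_pKer_iff_mem_graph {R E F : Type*} [Ring R] [AddCommGroup E] [Module R E]
    [AddCommGroup F] [Module R F] (T : E →ₗ.[R] F) {x : E} :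
    x ∈ T.pKer ↔ (x, 0) ∈ T.graph := by
  simp only [pKer, Submodule.mem_map, LinearMap.mem_ker, mem_graph_iff, Submodule.subtype_apply,
    toFun_eq_coe]
  exact exists_congr fun _ => and_comm

variable {𝕜 E F : Type*} [RCLike 𝕜] [NormedAddCommGroup E] [InnerProductSpace 𝕜 E]
  [NormedAddCommGroup F] [InnerProductSpace 𝕜 F] [CompleteSpace E]

/-- The kernel of the adjoint is the orthogonal complement of the range. -/
theorem pKer_adjoint_eq_orthogonal_pRange {T : E →ₗ.[𝕜] F} (hT : Dense (T.domain : Set E)) :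
    (T†).pKer = T.pRangeᗮ := by
  ext y
  rw [mem_pKer_iff_mem_graph, adjoint_graph_eq_graph_adjoint hT,
    Submodule.mem_adjoint_iff, Submodule.mem_orthogonal]
  constructor
  · rintro h _ ⟨x, rfl⟩
    simpa using h x (T x) (mem_graph T x)
  · intro h a b hab
    obtain ⟨x, -, hx⟩ := (mem_graph_iff T).1 hab
    simpa using h b ⟨x, hx⟩

/-- The kernel of a closed densely defined operator is the orthogonal complement of the range of
its adjoint. -/
theorem pKer_eq_orthogonal_pRange_adjoint [CompleteSpace F] {T : E →ₗ.[𝕜] F}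
    (hT : Dense (T.domain : Set E)) (hc : T.IsClosed) :
    T.pKer = (T†).pRangeᗮ := by
  ext x
  rw [mem_pKer_iff_mem_graph, Submodule.mem_orthogonal]
  constructor
  · rintro hx _ ⟨y, rfl⟩
    obtain ⟨z, rfl, hz⟩ := (mem_graph_iff T).1 hx
    rw [toFun_eq_coe, adjoint_isFormalAdjoint hT y z, hz, inner_zero_right]
  · intro hx
    let G : Submodule 𝕜 (WithLp 2 (E × F)) :=
      T.graph.comap (WithLp.linearEquiv 2 𝕜 (E × F)).toLinearMap
    have hG : _root_.IsClosed (G : Set (WithLp 2 (E × F))) :=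
      hc.preimage (WithLp.prod_continuous_ofLp 2 E F)
    suffices h : WithLp.toLp 2 (x, (0 : F)) ∈ Gᗮᗮ by
      rw [Submodule.orthogonal_orthogonal_eq_closure, hG.submodule_topologicalClosure_eq] at h
      exact h
    rw [Submodule.mem_orthogonal]
    intro u hu
    have hgraph : (u.snd, -u.fst) ∈ (T†).graph := by
      rw [adjoint_graph_eq_graph_adjoint hT, Submodule.mem_adjoint_iff]
      intro a b hab
      have h := (Submodule.mem_orthogonal _ _).1 hu (WithLp.toLp 2 (a, b)) hab
      rw [WithLp.prod_inner_apply] at h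
      rw [inner_neg_right, sub_neg_eq_add, add_comm]
      exact h
    obtain ⟨y, -, hy⟩ := (mem_graph_iff _).1 hgraph
    have h := hx (-u.fst) ⟨y, hy⟩
    rw [inner_neg_left, neg_eq_zero] at h
    simpa [WithLp.prod_inner_apply] using h

end LinearPMap

/-- Abstract strong Hodge decomposition: if $A$ is closed densely defined with $A^2 = 0$
and both $A$ and $A^*$ have closed range, then
$H = (\ker A \cap \ker A^*) \oplus \mathrm{ran}\,A \oplus \mathrm{ran}\,A^*$ orthogonally. -/
theorem statement3 {H : Type*}
    [NormedAddCommGroup H] [InnerProductSpace ℂ H] [CompleteSpace H]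
    (A : H →ₗ.[ℂ] H) (hclosed : A.IsClosed) (hdense : Dense (A.domain : Set H))
    (hA2 : A.pRange ≤ A.pKer)
    (hrA : IsClosed (A.pRange : Set H)) (hrA' : IsClosed ((A†).pRange : Set H)) :
    (A.pKer ⊓ (A†).pKer) ⟂ A.pRange ∧
    (A.pKer ⊓ (A†).pKer) ⟂ (A†).pRange ∧
    A.pRange ⟂ (A†).pRange ∧
    (A.pKer ⊓ (A†).pKer) ⊔ A.pRange ⊔ (A†).pRange = ⊤ := by
  have hker := LinearPMap.pKer_eq_orthogonal_pRange_adjoint hdense hclosed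
  have hker' := LinearPMap.pKer_adjoint_eq_orthogonal_pRange hdense
  have : CompleteSpace A.pRange := hrA.completeSpace_coe
  have : CompleteSpace (A†).pRange := hrA'.completeSpace_coe
  rw [hker] at hA2 ⊢
  rw [hker']
  refine ⟨(Submodule.isOrtho_orthogonal_left _).mono_left inf_le_right,
    (Submodule.isOrtho_orthogonal_left _).mono_left inf_le_left, hA2, ?_⟩
  rw [inf_comm, sup_comm _ A.pRange, Submodule.sup_orthogonal_inf_of_hasOrthogonalProjection hA2,
    sup_comm, Submodule.sup_orthogonal_of_hasOrthogonalProjection]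
end
end

section
/- Let A be a closed densely defined operator on a Hilbert space H with range(A) ⊆ ker(A). If the quotient ker(A)/range(A) is finite dimensional, then range(A) is closed in H. -/
open scoped LinearPMap InnerProductSpace ComplexConjugate

noncomputable section

theorem ContinuousLinearMap.isClosed_range_of_finiteDimensional_quotient {E F : Type*}
    [NormedAddCommGroup E] [NormedSpace ℂ E] [CompleteSpace E]
    [NormedAddCommGroup F] [NormedSpace ℂ F] [CompleteSpace F]
    (f : E →L[ℂ] F) (hf : FiniteDimensional ℂ (F ⧸ f.range)) :
    IsClosed (f.range : Set F) := by
  obtain ⟨C, hC⟩ := f.range.exists_isCompl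
  have : FiniteDimensional ℂ C :=
    (Submodule.quotientEquivOfIsCompl _ C hC).finiteDimensional
  have : CompleteSpace C := FiniteDimensional.complete ℂ C
  let g : (E × C) →L[ℂ] F := f.coprod C.subtypeL
  have hg : Function.Surjective g := by
    intro y
    obtain ⟨_, ⟨x, rfl⟩, c, hc, rfl⟩ :=
      Submodule.mem_sup.1 (hC.sup_eq_top ▸ Submodule.mem_top : y ∈ f.range ⊔ C)
    exact ⟨(x, ⟨c, hc⟩), rfl⟩
  rw [← (g.isQuotientMap hg).isClosed_preimage]
  have hpre : g ⁻¹' (f.range : Set F) = {p : E × C | p.2 = 0} := by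
    ext ⟨x, c⟩
    change f x + (c : F) ∈ f.range ↔ c = 0
    rw [Submodule.add_mem_iff_right _ (⟨x, rfl⟩ : f x ∈ f.range)]
    refine ⟨fun h => Subtype.ext (Submodule.disjoint_def.1 hC.disjoint _ h c.2), ?_⟩
    rintro rfl
    exact zero_mem _
  rw [hpre]
  exact isClosed_eq continuous_snd continuous_const

theorem LinearPMap.mem_pKer_iff {R E F : Type*} [Ring R] [AddCommGroup E] [Module R E]
    [AddCommGroup F] [Module R F] (T : E →ₗ.[R] F) (x : E) :
    x ∈ T.pKer ↔ (x, (0 : F)) ∈ T.graph := by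
  simp [LinearPMap.pKer, LinearPMap.mem_graph_iff]

theorem LinearPMap.mem_pRange_iff {R E F : Type*} [Ring R] [AddCommGroup E] [Module R E]
    [AddCommGroup F] [Module R F] (T : E →ₗ.[R] F) (y : F) :
    y ∈ T.pRange ↔ ∃ x, (x, y) ∈ T.graph := by
  simp [LinearPMap.pRange, LinearPMap.mem_graph_iff]

theorem LinearPMap.IsClosed.isClosed_pKer {E F : Type*}
    [NormedAddCommGroup E] [NormedSpace ℂ E] [NormedAddCommGroup F] [NormedSpace ℂ F]
    {T : E →ₗ.[ℂ] F} (hT : T.IsClosed) : _root_.IsClosed (T.pKer : Set E) := by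
  have h : (T.pKer : Set E) = (fun x => (x, (0 : F))) ⁻¹' (T.graph : Set (E × F)) :=
    Set.ext T.mem_pKer_iff
  rw [h]
  exact _root_.IsClosed.preimage (by fun_prop) hT

/-- If $A$ is closed densely defined with $A^2=0$ and the cohomology
$\ker A/\mathrm{ran}\,A$ is finite dimensional, then $\mathrm{ran}\,A$ is closed. -/
theorem statement5 {H : Type*}
    [NormedAddCommGroup H] [InnerProductSpace ℂ H] [CompleteSpace H]
    (A : H →ₗ.[ℂ] H) (hclosed : A.IsClosed) (hdense : Dense (A.domain : Set H))
    (hA2 : A.pRange ≤ A.pKer)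
    (hfin : FiniteDimensional ℂ (A.pKer ⧸ A.pRange.comap A.pKer.subtype)) :
    IsClosed (A.pRange : Set H) := by
  have hK := hclosed.isClosed_pKer
  have : CompleteSpace A.pKer := hK.completeSpace_coe
  have : CompleteSpace A.graph := _root_.IsClosed.completeSpace_coe (hs := hclosed)
  let f : A.graph →L[ℂ] A.pKer :=
    ((ContinuousLinearMap.snd ℂ H H).comp A.graph.subtypeL).codRestrict A.pKer
      fun p => hA2 ((A.mem_pRange_iff _).2 ⟨p.1.1, p.2⟩)
  have hf : f.range = A.pRange.comap A.pKer.subtype := by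
    ext y
    rw [Submodule.mem_comap, Submodule.subtype_apply, A.mem_pRange_iff]
    constructor
    · rintro ⟨p, rfl⟩
      exact ⟨p.1.1, p.2⟩
    · rintro ⟨x, hx⟩
      exact ⟨⟨(x, y), hx⟩, rfl⟩
  have hr := f.isClosed_range_of_finiteDimensional_quotient (hf ▸ hfin)
  have himage : (A.pRange : Set H) = Subtype.val '' (f.range : Set A.pKer) := by
    rw [hf]
    ext y
    exact ⟨fun hy => ⟨⟨y, hA2 hy⟩, hy, rfl⟩, by rintro ⟨z, hz, rfl⟩; exact hz⟩
  rw [himage]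
  exact hK.isClosedEmbedding_subtypeVal.isClosedMap _ hr
end
end

section
/- Let A be a closed densely defined operator on a Hilbert space H with A² = 0, and suppose there exist constants c₁, c₂ > 0 with ‖Ax‖ ≥ c₁‖x‖ for x ∈ Dom(A) ∩ (ker A)^⊥ and ‖A*y‖ ≥ c₂‖y‖ for y ∈ Dom(A*) ∩ (ker A*)^⊥. Then there exists c > 0 such that for every ψ ∈ Dom(A) ∩ Dom(A*) orthogonal to ker A ∩ ker A*, one has ‖Aψ‖² + ‖A*ψ‖² ≥ c‖ψ‖². -/
open scoped LinearPMap InnerProductSpace ComplexConjugate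

noncomputable section

namespace LinearPMap

lemma mem_pKer_iff_s6 {R E F : Type*} [Ring R] [AddCommGroup E] [Module R E]
    [AddCommGroup F] [Module R F] {T : E →ₗ.[R] F} {x : E} :
    x ∈ T.pKer ↔ ∃ hx : x ∈ T.domain, T ⟨x, hx⟩ = 0 := by
  simp only [pKer, Submodule.mem_map, LinearMap.mem_ker]
  constructor
  · rintro ⟨y, hy, rfl⟩
    exact ⟨y.2, hy⟩
  · rintro ⟨hx, h⟩
    exact ⟨⟨x, hx⟩, h, rfl⟩

lemma sub_mem_domain_and_apply_eq {R E F : Type*} [Ring R] [AddCommGroup E] [Module R E]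
    [AddCommGroup F] [Module R F] {T : E →ₗ.[R] F} {x k : E} (hx : x ∈ T.domain)
    (hk : k ∈ T.pKer) : ∃ h : x - k ∈ T.domain, T ⟨x - k, h⟩ = T ⟨x, hx⟩ := by
  obtain ⟨hk, hk0⟩ := mem_pKer_iff_s6.1 hk
  refine ⟨T.domain.sub_mem hx hk, ?_⟩
  have h := T.map_sub ⟨x, hx⟩ ⟨k, hk⟩
  rw [hk0, sub_zero] at h
  exact h

lemma IsClosed.isClosed_pKer_s6 {R E F : Type*} [CommRing R] [AddCommGroup E] [Module R E]
    [AddCommGroup F] [Module R F] [TopologicalSpace E] [TopologicalSpace F]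
    {T : E →ₗ.[R] F} (hT : T.IsClosed) : _root_.IsClosed (T.pKer : Set E) := by
  have h : (T.pKer : Set E) = (fun x : E => (x, (0 : F))) ⁻¹' (T.graph : Set (E × F)) := by
    ext x
    simp only [SetLike.mem_coe, Set.mem_preimage, mem_pKer_iff_s6, mem_graph_iff]
    constructor
    · rintro ⟨hx, h⟩
      exact ⟨⟨x, hx⟩, rfl, h⟩
    · rintro ⟨y, rfl, h⟩
      exact ⟨y.2, h⟩
  rw [h]
  exact _root_.IsClosed.preimage (by fun_prop) hT

lemma orthogonal_pRange_le_pKer_adjoint {𝕜 E F : Type*} [RCLike 𝕜]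
    [NormedAddCommGroup E] [InnerProductSpace 𝕜 E] [CompleteSpace E]
    [NormedAddCommGroup F] [InnerProductSpace 𝕜 F] {T : E →ₗ.[𝕜] F}
    (hT : Dense (T.domain : Set E)) : T.pRangeᗮ ≤ T†.pKer := by
  intro y hy
  have h : ∀ x : T.domain, ⟪(0 : E), x⟫_𝕜 = ⟪y, T x⟫_𝕜 := fun x => by
    rw [inner_zero_left]
    exact (Submodule.inner_left_of_mem_orthogonal (LinearMap.mem_range_self T.toFun x) hy).symm
  exact mem_pKer_iff_s6.2 ⟨mem_adjoint_domain_of_exists y ⟨0, h⟩, adjoint_apply_eq hT _ h⟩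

end LinearPMap

/-- Spectral-gap estimate: lower bounds for $A$ and $A^*$ off their kernels give a
joint lower bound $\|A\psi\|^2+\|A^*\psi\|^2 \ge c\|\psi\|^2$ for $\psi$ orthogonal to
the harmonic space. -/
theorem statement6 {H : Type*}
    [NormedAddCommGroup H] [InnerProductSpace ℂ H] [CompleteSpace H]
    (A : H →ₗ.[ℂ] H) (hclosed : A.IsClosed) (hdense : Dense (A.domain : Set H))
    (hA2 : A.pRange ≤ A.pKer)
    (c₁ c₂ : ℝ) (hc₁ : 0 < c₁) (hc₂ : 0 < c₂)
    (hbound₁ : ∀ x : A.domain, (x : H) ∈ A.pKerᗮ → c₁ * ‖(x : H)‖ ≤ ‖A x‖)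
    (hbound₂ : ∀ y : (A†).domain, (y : H) ∈ (A†).pKerᗮ → c₂ * ‖(y : H)‖ ≤ ‖A† y‖) :
    ∃ c : ℝ, 0 < c ∧ ∀ (ψ : H) (hψ : ψ ∈ A.domain) (hψ' : ψ ∈ (A†).domain),
      ψ ∈ (A.pKer ⊓ (A†).pKer)ᗮ →
      c * ‖ψ‖ ^ 2 ≤ ‖A ⟨ψ, hψ⟩‖ ^ 2 + ‖A† ⟨ψ, hψ'⟩‖ ^ 2 := by
  have : CompleteSpace A.pKer := hclosed.isClosed_pKer_s6.completeSpace_coe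
  have hker : A.pKerᗮ ≤ (A†).pKer := (Submodule.orthogonal_le hA2).trans
    (LinearPMap.orthogonal_pRange_le_pKer_adjoint hdense)
  refine ⟨min (c₁ ^ 2) (c₂ ^ 2), by positivity, fun ψ hψ hψ' horth => ?_⟩
  obtain ⟨u, hu, v, hv, rfl⟩ := A.pKer.exists_add_mem_mem_orthogonal ψ
  have hu' : u ∈ (A†).pKerᗮ := by
    intro w hw
    obtain ⟨w₁, hw₁, w₂, hw₂, rfl⟩ := A.pKer.exists_add_mem_mem_orthogonal w
    have hw₁' : w₁ ∈ (A†).pKer := by simpa using sub_mem hw (hker hw₂)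
    have h := horth w₁ ⟨hw₁, hw₁'⟩
    rw [inner_add_right, hv w₁ hw₁, add_zero] at h
    rw [inner_add_left, h, Submodule.inner_left_of_mem_orthogonal hu hw₂, add_zero]
  obtain ⟨hvdom, hAv⟩ := LinearPMap.sub_mem_domain_and_apply_eq hψ hu
  obtain ⟨hudom, hAu⟩ := LinearPMap.sub_mem_domain_and_apply_eq hψ' (hker hv)
  have h₁ := hbound₁ ⟨_, hvdom⟩ (by simpa using hv)
  have h₂ := hbound₂ ⟨_, hudom⟩ (by simpa using hu')
  rw [hAv] at h₁
  rw [hAu] at h₂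
  simp only [add_sub_cancel_left] at h₁
  simp only [add_sub_cancel_right] at h₂
  have hpyth : ‖u + v‖ ^ 2 = ‖u‖ ^ 2 + ‖v‖ ^ 2 := by
    simpa only [sq] using norm_add_sq_eq_norm_sq_add_norm_sq_of_inner_eq_zero u v (hv u hu)
  calc min (c₁ ^ 2) (c₂ ^ 2) * ‖u + v‖ ^ 2
      = min (c₁ ^ 2) (c₂ ^ 2) * ‖v‖ ^ 2 + min (c₁ ^ 2) (c₂ ^ 2) * ‖u‖ ^ 2 := by
        rw [hpyth]; ring
    _ ≤ c₁ ^ 2 * ‖v‖ ^ 2 + c₂ ^ 2 * ‖u‖ ^ 2 := by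
        gcongr
        · exact min_le_left _ _
        · exact min_le_right _ _
    _ = (c₁ * ‖v‖) ^ 2 + (c₂ * ‖u‖) ^ 2 := by ring
    _ ≤ _ := by gcongr
end
end

section
/- Let R be a commutative ring and f₁, …, fₙ ∈ R a regular sequence. The Koszul cohomology of the complex Rⁿ-exterior-algebra with differential d(ω) = (f₁e₁ + ⋯ + fₙeₙ) ∧ ω vanishes in all degrees p < n, and in degree n equals R/(f₁,…,fₙ). -/
noncomputable section

open ExteriorAlgebra

/-- The Koszul differential `⋀ᵖ(Rⁿ) → ⋀ᵖ⁺¹(Rⁿ)` (for a general module `M`):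
wedging on the left with the vector `v = Σᵢ fᵢ eᵢ`. -/
def koszulD (R : Type*) [CommRing R] {M : Type*} [AddCommGroup M] [Module R M]
    (v : M) (p : ℕ) : ⋀[R]^p M →ₗ[R] ⋀[R]^(p + 1) M where
  toFun x := ⟨ExteriorAlgebra.ι R v * (x : ExteriorAlgebra R M), by
    have : (⋀[R]^(p+1) M) = LinearMap.range (ι R (M := M)) * ⋀[R]^p M := pow_succ' _ _
    rw [this]
    exact Submodule.mul_mem_mul (LinearMap.mem_range_self _ v) x.2⟩
  map_add' x y := Subtype.ext (by simp [mul_add])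
  map_smul' c x := Subtype.ext (by simp [mul_smul_comm])

namespace ExteriorAlgebra

variable {R : Type*} [CommRing R] {n : ℕ}

lemma ι_mul_ι_mul_self {M : Type*} [AddCommGroup M] [Module R M] (v : M)
    (x : ExteriorAlgebra R M) : ι R v * (ι R v * x) = 0 := by
  rw [← mul_assoc, ι_sq_zero, zero_mul]

lemma ι_mul_ι_mul_comm {M : Type*} [AddCommGroup M] [Module R M] (v w : M)
    (x : ExteriorAlgebra R M) : ι R v * (ι R w * x) = -(ι R w * (ι R v * x)) := by
  rw [← mul_assoc, ← mul_assoc, eq_neg_iff_add_eq_zero, ← add_mul, ι_add_mul_swap, zero_mul]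

lemma ι_mem_exteriorPower_one {M : Type*} [AddCommGroup M] [Module R M] (v : M) :
    ι R v ∈ ⋀[R]^1 M := by
  rw [exteriorPower, pow_one]
  exact LinearMap.mem_range_self _ v

/-- Contraction of an element of `Λ(Rⁿ)` with the `i`-th coordinate form. -/
def contractCoord (i : Fin n) :
    ExteriorAlgebra R (Fin n → R) →ₗ[R] ExteriorAlgebra R (Fin n → R) :=
  CliffordAlgebra.contractLeft (Q := (0 : QuadraticForm R (Fin n → R))) (LinearMap.proj i)

lemma contractCoord_ι_mul (i : Fin n) (v : Fin n → R) (x : ExteriorAlgebra R (Fin n → R)) :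
    contractCoord i (ι R v * x) = v i • x - ι R v * contractCoord i x :=
  CliffordAlgebra.contractLeft_ι_mul _ _ _

lemma contractCoord_contractCoord (i : Fin n) (x : ExteriorAlgebra R (Fin n → R)) :
    contractCoord i (contractCoord i x) = 0 :=
  CliffordAlgebra.contractLeft_contractLeft _ _

lemma ι_mul_eq_sum (v : Fin n → R) (x : ExteriorAlgebra R (Fin n → R)) :
    ι R v * x = ∑ i, v i • (ι R (Pi.single i 1) * x) := by
  conv_lhs => rw [← Finset.univ_sum_single v, map_sum, Finset.sum_mul]
  refine Finset.sum_congr rfl fun i _ => ?_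
  rw [← smul_mul_assoc, ← map_smul, ← Pi.single_smul, smul_eq_mul, mul_one]

/-- The elements of `Λ(Rⁿ)` killed by `e₀, …, eₖ₋₁`. -/
def annihilatedBelow (R : Type*) [CommRing R] (n k : ℕ) :
    Submodule R (ExteriorAlgebra R (Fin n → R)) where
  carrier := {x | ∀ i : Fin n, i.val < k → ι R (Pi.single i 1) * x = 0}
  add_mem' hx hy i hi := by rw [mul_add, hx i hi, hy i hi, add_zero]
  zero_mem' i _ := mul_zero _
  smul_mem' r x hx i hi := by rw [mul_smul_comm, hx i hi, smul_zero]

lemma ι_mul_mem_annihilatedBelow_succ {k : ℕ} (hk : k < n)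
    {x : ExteriorAlgebra R (Fin n → R)} (hx : x ∈ annihilatedBelow R n k) :
    ι R (Pi.single ⟨k, hk⟩ 1) * x ∈ annihilatedBelow R n (k + 1) := by
  intro i hi
  rcases Nat.lt_succ_iff_lt_or_eq.mp hi with hi | hi
  · rw [ι_mul_ι_mul_comm, hx i hi, mul_zero, neg_zero]
  · obtain rfl : i = ⟨k, hk⟩ := Fin.ext hi
    exact ι_mul_ι_mul_self _ _

lemma contractCoord_mem_annihilatedBelow {k : ℕ} (hk : k < n)
    {x : ExteriorAlgebra R (Fin n → R)} (hx : x ∈ annihilatedBelow R n k) :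
    contractCoord ⟨k, hk⟩ x ∈ annihilatedBelow R n k := by
  intro i hi
  have h := contractCoord_ι_mul ⟨k, hk⟩ (Pi.single i 1) x
  rw [hx i hi, map_zero, Pi.single_eq_of_ne (by simp [Fin.ext_iff]; omega), zero_smul,
    zero_sub, eq_comm, neg_eq_zero] at h
  exact h

lemma ι_mul_contractCoord_of_mem {k : ℕ} (hk : k < n)
    {x : ExteriorAlgebra R (Fin n → R)} (hx : x ∈ annihilatedBelow R n (k + 1)) :
    ι R (Pi.single ⟨k, hk⟩ 1) * contractCoord ⟨k, hk⟩ x = x := by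
  have h := contractCoord_ι_mul ⟨k, hk⟩ (Pi.single ⟨k, hk⟩ 1) x
  rw [hx ⟨k, hk⟩ k.lt_succ_self, map_zero, Pi.single_eq_same, one_smul, eq_comm, sub_eq_zero] at h
  exact h.symm

lemma annihilatedBelow_anti {j k : ℕ} (h : j ≤ k) :
    annihilatedBelow R n k ≤ annihilatedBelow R n j :=
  fun _ hx i hi => hx i (hi.trans_le h)

/-- `annihilatedBelow R n k` is a retract of `Λ(Rⁿ)`. -/
lemma exists_projection_annihilatedBelow {k : ℕ} (hk : k ≤ n) :
    ∃ P : ExteriorAlgebra R (Fin n → R) →ₗ[R] ExteriorAlgebra R (Fin n → R),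
      (∀ x, P x ∈ annihilatedBelow R n k) ∧ ∀ x ∈ annihilatedBelow R n k, P x = x := by
  induction k with
  | zero => exact ⟨LinearMap.id, fun x i hi => absurd hi (Nat.not_lt_zero _), fun x _ => rfl⟩
  | succ k ih =>
    obtain ⟨P, hP, hP'⟩ := ih (Nat.le_of_succ_le hk)
    refine ⟨LinearMap.mulLeft R (ι R (Pi.single ⟨k, hk⟩ 1)) ∘ₗ contractCoord ⟨k, hk⟩ ∘ₗ P,
      fun x => ?_, fun x hx => ?_⟩
    · exact ι_mul_mem_annihilatedBelow_succ hk (contractCoord_mem_annihilatedBelow hk (hP x))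
    · simp only [LinearMap.comp_apply, LinearMap.mulLeft_apply]
      rw [hP' x (annihilatedBelow_anti k.le_succ hx), ι_mul_contractCoord_of_mem hk hx]

/-- `annihilatedBelow R n k` lies in the right ideal generated by an element of `Λᵏ(Rⁿ)`,
namely `eₖ₋₁ ∧ ⋯ ∧ e₀`. -/
lemma exists_generator_annihilatedBelow (R : Type*) [CommRing R] {n k : ℕ} (hk : k ≤ n) :
    ∃ w ∈ ⋀[R]^k (Fin n → R), ∀ x ∈ annihilatedBelow R n k, ∃ y, x = w * y := by
  induction k with
  | zero => exact ⟨1, Submodule.one_le.mp (by simp), fun x _ => ⟨x, (one_mul x).symm⟩⟩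
  | succ k ih =>
    obtain ⟨w, hw, h⟩ := ih (Nat.le_of_succ_le hk)
    refine ⟨ι R (Pi.single ⟨k, hk⟩ 1) * w, ?_, fun x hx => ?_⟩
    · exact (koszulD R (Pi.single ⟨k, hk⟩ 1) k ⟨w, hw⟩).2
    · obtain ⟨y, hy⟩ := h _ (contractCoord_mem_annihilatedBelow hk
        (annihilatedBelow_anti k.le_succ hx))
      exact ⟨y, by rw [mul_assoc, ← hy, ι_mul_contractCoord_of_mem hk hx]⟩

/-- The vector `(f₀, …, fₖ₋₁, 0, …, 0)`. -/
def truncate (f : Fin n → R) (k : ℕ) : Fin n → R := fun i => if i.val < k then f i else 0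

lemma truncate_succ (f : Fin n → R) {k : ℕ} (hk : k < n) :
    truncate f (k + 1) = truncate f k + f ⟨k, hk⟩ • Pi.single ⟨k, hk⟩ 1 := by
  ext i
  by_cases h : i = ⟨k, hk⟩
  · subst h; simp [truncate]
  · have : i.val ≠ k := fun h' => h (Fin.ext h')
    have h2 : i.val < k + 1 ↔ i.val < k := by omega
    simp [truncate, h, h2]

lemma truncate_self (f : Fin n → R) : truncate f n = f := by
  ext i; simp [truncate]

lemma truncate_mul_of_mem {f : Fin n → R} {k : ℕ} {x : ExteriorAlgebra R (Fin n → R)}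
    (hx : x ∈ annihilatedBelow R n k) : ι R (truncate f k) * x = 0 := by
  rw [ι_mul_eq_sum]
  refine Finset.sum_eq_zero fun i _ => ?_
  by_cases hi : i.val < k
  · rw [hx i hi, smul_zero]
  · simp [truncate, hi]

lemma mem_take_ofFn {α : Type*} {f : Fin n → α} {k : ℕ} {r : α} :
    r ∈ (List.ofFn f).take k ↔ ∃ i : Fin n, i.val < k ∧ f i = r := by
  simp only [List.mem_take_iff_getElem, List.getElem_ofFn, List.length_ofFn]
  constructor
  · rintro ⟨i, hi, rfl⟩
    exact ⟨⟨i, by omega⟩, by simp; omega, rfl⟩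
  · rintro ⟨i, hi, rfl⟩
    exact ⟨i, by have := i.2; omega, rfl⟩

lemma truncate_mul_mem_smul_top (f : Fin n → R) (k : ℕ) (x : ExteriorAlgebra R (Fin n → R)) :
    ι R (truncate f k) * x ∈ (Ideal.ofList ((List.ofFn f).take k) •
      ⊤ : Submodule R (ExteriorAlgebra R (Fin n → R))) := by
  rw [ι_mul_eq_sum]
  refine Submodule.sum_mem _ fun i _ => Submodule.smul_mem_smul ?_ trivial
  by_cases hi : i.val < k
  · rw [truncate, if_pos hi]
    exact Ideal.subset_span (mem_take_ofFn.mpr ⟨i, hi, rfl⟩)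
  · simp [truncate, hi]

lemma exists_truncate_mul_eq_of_mem {f : Fin n → R} {k : ℕ} (hk : k ≤ n)
    {x : ExteriorAlgebra R (Fin n → R)} (hx : x ∈ annihilatedBelow R n k)
    (hx' : x ∈ (Ideal.ofList ((List.ofFn f).take k) •
      ⊤ : Submodule R (ExteriorAlgebra R (Fin n → R)))) :
    ∃ y, ι R (truncate f k) * y = x := by
  obtain ⟨P, hP, hP'⟩ := exists_projection_annihilatedBelow (R := R) hk
  suffices h : (Ideal.ofList ((List.ofFn f).take k) •
      ⊤ : Submodule R (ExteriorAlgebra R (Fin n → R))) ≤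
      (LinearMap.range (LinearMap.mulLeft R (ι R (truncate f k)))).comap P by
    have := h hx'
    rwa [Submodule.mem_comap, hP' x hx] at this
  refine Submodule.smul_le.mpr fun r hr y _ => ?_
  induction hr using Submodule.span_induction with
  | mem r hr =>
    obtain ⟨i, hi, rfl⟩ := mem_take_ofFn.mp hr
    refine ⟨contractCoord i (P y), ?_⟩
    have h := contractCoord_ι_mul i (truncate f k) (P y)
    rw [truncate_mul_of_mem (hP y), map_zero, eq_comm, sub_eq_zero] at h
    rw [LinearMap.mulLeft_apply, ← h, map_smul, truncate, if_pos hi]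
  | zero => rw [zero_smul]; exact Submodule.zero_mem _
  | add a b _ _ ha hb => rw [add_smul]; exact Submodule.add_mem _ ha hb
  | smul a b _ hb => rw [smul_assoc]; exact Submodule.smul_mem _ a hb

lemma isWeaklyRegular {rs : List R} (h : RingTheory.Sequence.IsWeaklyRegular R rs) :
    RingTheory.Sequence.IsWeaklyRegular (ExteriorAlgebra R (Fin n → R)) rs := by
  have : Module.Free R (ExteriorAlgebra R (Fin n → R)) :=
    .of_basis (Pi.basisFun R (Fin n)).ExteriorAlgebra
  exact ((TensorProduct.rid R _).isWeaklyRegular_congr rs).mp h.isWeaklyRegular_lTensor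

/-- Exactness of the Koszul complex of a regular sequence, up to multiples of `e₀ ∧ ⋯ ∧ eₖ₋₁`. -/
lemma exists_eq_truncate_mul_add {f : Fin n → R}
    (hreg : RingTheory.Sequence.IsWeaklyRegular R (List.ofFn f)) {k : ℕ} (hk : k ≤ n)
    {x : ExteriorAlgebra R (Fin n → R)} (hx : ι R (truncate f k) * x = 0) :
    ∃ y, ∃ z ∈ annihilatedBelow R n k, x = ι R (truncate f k) * y + z := by
  induction k generalizing x with
  | zero => exact ⟨0, x, fun i hi => absurd hi (Nat.not_lt_zero _), by simp⟩
  | succ k ih =>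
    replace ih := @ih (Nat.le_of_succ_le hk)
    set v := truncate f k with hv
    set r := f ⟨k, hk⟩ with hr
    set e : Fin n → R := Pi.single ⟨k, hk⟩ 1 with he
    have hmul (y) : ι R (truncate f (k + 1)) * y = ι R v * y + r • (ι R e * y) := by
      rw [truncate_succ f hk, map_add, map_smul, add_mul, smul_mul_assoc]
    have hce (y) : contractCoord ⟨k, hk⟩ (ι R e * y) =
        y - ι R e * contractCoord ⟨k, hk⟩ y := by
      rw [contractCoord_ι_mul, he, Pi.single_eq_same, one_smul]
    have hcv (y) : contractCoord ⟨k, hk⟩ (ι R v * y) =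
        -(ι R v * contractCoord ⟨k, hk⟩ y) := by
      rw [contractCoord_ι_mul, hv, truncate, if_neg (lt_irrefl k), zero_smul, zero_sub]
    obtain ⟨a, b, ha, hb, hab⟩ : ∃ a b, contractCoord ⟨k, hk⟩ a = 0 ∧
        contractCoord ⟨k, hk⟩ b = 0 ∧ x = a + ι R e * b :=
      ⟨contractCoord ⟨k, hk⟩ (ι R e * x), contractCoord ⟨k, hk⟩ x,
        contractCoord_contractCoord _ _, contractCoord_contractCoord _ _, by rw [hce]; abel⟩
    have hx1 : ι R v * a + ι R e * (r • a - ι R v * b) = 0 := by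
      rw [← hx, hmul, hab, mul_add, mul_add, ι_mul_ι_mul_self, ι_mul_ι_mul_comm v e, mul_sub,
        mul_smul_comm]
      simp only [smul_add, smul_zero]
      abel
    have hab' : r • a = ι R v * b := by
      have h := congrArg (contractCoord ⟨k, hk⟩) hx1
      rw [map_add, hcv, hce, ha, map_sub, map_smul, ha, hcv, hb] at h
      simpa [sub_eq_zero] using h
    have hva : ι R v * a = 0 := by
      rwa [hab', sub_self, mul_zero, add_zero] at hx1
    obtain ⟨y, hy⟩ : ∃ y, a = ι R v * y := by
      obtain ⟨y, z, hz, hyz⟩ := ih hva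
      have hrz : r • z = ι R v * (b - r • y) := by
        rw [mul_sub, ← hab', mul_smul_comm, hyz, smul_add]
        abel
      have hreg' := (isWeaklyRegular (n := n) hreg).regular_mod_prev k (by simpa using hk)
      have hz' : z ∈ (Ideal.ofList ((List.ofFn f).take k) •
          ⊤ : Submodule R (ExteriorAlgebra R (Fin n → R))) := by
        rw [← Submodule.Quotient.mk_eq_zero]
        apply hreg'
        simp only [List.getElem_ofFn, smul_zero]
        rw [← Submodule.Quotient.mk_smul, Submodule.Quotient.mk_eq_zero, ← hr, hrz]
        exact truncate_mul_mem_smul_top f k _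
      obtain ⟨u, hu⟩ := exists_truncate_mul_eq_of_mem (Nat.le_of_succ_le hk) hz hz'
      exact ⟨y + u, by rw [mul_add, hu, hyz]⟩
    obtain ⟨u, z, hz, hbz⟩ := @ih (b - r • y) (by
      rw [mul_sub, ← hab', mul_smul_comm, hy, sub_self])
    refine ⟨y - ι R e * u, ι R e * z, ι_mul_mem_annihilatedBelow_succ hk hz, ?_⟩
    rw [hmul, mul_sub, mul_sub, ι_mul_ι_mul_self, ι_mul_ι_mul_comm v e, hab, hy,
      sub_eq_iff_eq_add.mp hbz]
    simp only [mul_add, mul_smul_comm, sub_zero]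
    abel

end ExteriorAlgebra

section Koszul

variable {R : Type*} [CommRing R] {n : ℕ}

lemma koszulD_koszulD {M : Type*} [AddCommGroup M] [Module R M] (v : M) (p : ℕ) (x : ⋀[R]^p M) :
    koszulD R v (p + 1) (koszulD R v p x) = 0 :=
  Subtype.ext (ι_mul_ι_mul_self v _)

/-- A homogeneous element that is a multiple of `v` is the image of a homogeneous element. -/
lemma mem_range_koszulD_of_eq_mul {M : Type*} [AddCommGroup M] [Module R M] {v : M} {p : ℕ}
    {x : ⋀[R]^(p + 1) M} {y : ExteriorAlgebra R M}
    (h : (x : ExteriorAlgebra R M) = ι R v * y) :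
    x ∈ LinearMap.range (koszulD R v p) := by
  refine ⟨DirectSum.decompose (fun i => ⋀[R]^i M) y p, Subtype.ext ?_⟩
  have h1 := DirectSum.coe_decompose_mul_add_of_left_mem (fun i => ⋀[R]^i M) (j := p) (b := y)
    (ι_mem_exteriorPower_one v)
  rw [← h, add_comm 1 p, DirectSum.decompose_coe, DirectSum.of_eq_same] at h1
  exact h1.symm

/-- The degree `p < n` component of a Koszul cocycle of a regular sequence is a multiple of `f`. -/
lemma exists_eq_mul_of_ι_mul_eq_zero {f : Fin n → R}
    (hreg : RingTheory.Sequence.IsWeaklyRegular R (List.ofFn f)) {p : ℕ} (hp : p < n)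
    {x : ExteriorAlgebra R (Fin n → R)} (hx : ι R f * x = 0) :
    ∃ y, (DirectSum.decompose (fun i => ⋀[R]^i (Fin n → R)) x p : ExteriorAlgebra R (Fin n → R)) =
      DirectSum.decompose (fun i => ⋀[R]^i (Fin n → R)) (ι R f * y) p := by
  obtain ⟨y, z, hz, h⟩ := exists_eq_truncate_mul_add hreg le_rfl
    (by rwa [truncate_self] : ι R (truncate f n) * x = 0)
  obtain ⟨w, hw, hw'⟩ := exists_generator_annihilatedBelow R (le_refl n)
  obtain ⟨u, rfl⟩ := hw' z hz
  refine ⟨y, ?_⟩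
  rw [h, truncate_self, DirectSum.decompose_add, DirectSum.add_apply, Submodule.coe_add,
    DirectSum.coe_decompose_mul_of_left_mem_of_not_le (fun i => ⋀[R]^i (Fin n → R)) hw
      (not_le.mpr hp), add_zero]

lemma ker_koszulD_zero {f : Fin n → R}
    (hreg : RingTheory.Sequence.IsWeaklyRegular R (List.ofFn f)) (hn : 0 < n) :
    LinearMap.ker (koszulD R f 0) = ⊥ := by
  refine (Submodule.eq_bot_iff _).mpr fun x hx => Subtype.ext ?_
  obtain ⟨y, hy⟩ := exists_eq_mul_of_ι_mul_eq_zero hreg hn (congrArg Subtype.val hx)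
  rwa [DirectSum.decompose_coe, DirectSum.of_eq_same,
    DirectSum.coe_decompose_mul_of_left_mem_of_not_le (fun i => ⋀[R]^i (Fin n → R))
      (ι_mem_exteriorPower_one f) (by simp)] at hy

lemma ker_koszulD_succ {f : Fin n → R}
    (hreg : RingTheory.Sequence.IsWeaklyRegular R (List.ofFn f)) {p : ℕ} (hp : p + 1 < n) :
    LinearMap.ker (koszulD R f (p + 1)) = LinearMap.range (koszulD R f p) := by
  refine le_antisymm (fun x hx => ?_) ?_
  · obtain ⟨y, hy⟩ := exists_eq_mul_of_ι_mul_eq_zero hreg hp (congrArg Subtype.val hx)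
    rw [DirectSum.decompose_coe, DirectSum.of_eq_same,
      DirectSum.coe_decompose_mul_of_left_mem_of_le (fun i => ⋀[R]^i (Fin n → R))
        (ι_mem_exteriorPower_one f) (Nat.le_add_left 1 p)] at hy
    exact mem_range_koszulD_of_eq_mul hy
  · rintro _ ⟨x, rfl⟩
    exact koszulD_koszulD f p x

lemma range_koszulD_top {m : ℕ} (f : Fin (m + 1) → R) :
    LinearMap.range (koszulD R f m) = Ideal.span (Set.range f) • ⊤ := by
  refine le_antisymm ?_ (Submodule.smul_le.mpr fun r hr x _ => ?_)
  · rintro _ ⟨x, rfl⟩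
    have h : koszulD R f m x = ∑ i, f i • koszulD R (Pi.single i 1) m x :=
      Subtype.ext (by simpa [koszulD] using ι_mul_eq_sum f x)
    rw [h]
    exact Submodule.sum_mem _ fun i _ =>
      Submodule.smul_mem_smul (Ideal.subset_span ⟨i, rfl⟩) trivial
  · have hfx : ι R f * (x : ExteriorAlgebra R (Fin (m + 1) → R)) = 0 := by
      have : IsEmpty (Set.powersetCard (Fin (m + 1)) (m + 1 + 1)) :=
        ⟨fun s => by have := s.1.card_le_univ; have := s.2; simp_all⟩
      have := ((Pi.basisFun R (Fin (m + 1))).exteriorPower (m + 1 + 1)).repr.toEquiv.subsingleton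
      exact congrArg Subtype.val (Subsingleton.elim (koszulD R f (m + 1) x) 0)
    induction hr using Submodule.span_induction with
    | mem r hr =>
      obtain ⟨i, rfl⟩ := hr
      have h := contractCoord_ι_mul i f (x : ExteriorAlgebra R (Fin (m + 1) → R))
      rw [hfx, map_zero, eq_comm, sub_eq_zero] at h
      exact mem_range_koszulD_of_eq_mul h
    | zero => rw [zero_smul]; exact Submodule.zero_mem _
    | add a b _ _ ha hb => rw [add_smul]; exact Submodule.add_mem _ ha hb
    | smul a b _ hb => rw [smul_assoc]; exact Submodule.smul_mem _ a hb

/-- The top exterior power of `Rⁿ` is free of rank one. -/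
def topExteriorPowerEquiv (R : Type*) [CommRing R] (n : ℕ) : ⋀[R]^n (Fin n → R) ≃ₗ[R] R :=
  haveI : Unique (Set.powersetCard (Fin n) n) :=
    { default := ⟨Finset.univ, by simp [Set.powersetCard]⟩
      uniq := fun s => Subtype.ext (Finset.eq_univ_of_card _ (by simp)) }
  ((Pi.basisFun R (Fin n)).exteriorPower n).repr.trans (Finsupp.uniqueLinearEquiv R R default)

/-- The top Koszul cohomology of `f` is the quotient by the ideal generated by `f`. -/
def topKoszulCohomologyEquiv {m : ℕ} (f : Fin (m + 1) → R) :
    (⋀[R]^(m + 1) (Fin (m + 1) → R) ⧸ LinearMap.range (koszulD R f m)) ≃ₗ[R]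
      R ⧸ Ideal.span (Set.range f) :=
  Submodule.Quotient.equiv _ _ (topExteriorPowerEquiv R (m + 1)) (by
    rw [range_koszulD_top, Submodule.map_smul'', Submodule.map_top, LinearEquiv.range]
    simp)

end Koszul

/-- For a regular sequence `f₁, …, fₙ` in a commutative ring `R`, the Koszul complex
`0 → Λ⁰Rⁿ → Λ¹Rⁿ → ⋯ → ΛⁿRⁿ → 0` with differential `ω ↦ (Σᵢ fᵢeᵢ) ∧ ω` has vanishing
cohomology in all degrees `p < n`, and in degree `n` its cohomology is `R/(f₁, …, fₙ)`. -/
theorem statement11 (R : Type*) [CommRing R] (n : ℕ) (f : Fin n → R)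
    (hreg : RingTheory.Sequence.IsRegular R (List.ofFn f)) :
    (0 < n → LinearMap.ker (koszulD R (M := Fin n → R) f 0) = ⊥) ∧
    (∀ p : ℕ, p + 1 < n →
      LinearMap.ker (koszulD R (M := Fin n → R) f (p + 1)) =
        LinearMap.range (koszulD R (M := Fin n → R) f p)) ∧
    (∀ m : ℕ, n = m + 1 →
      Nonempty
        ((↥(⋀[R]^(m + 1) (Fin n → R)) ⧸
            LinearMap.range (koszulD R (M := Fin n → R) f m)) ≃ₗ[R]
          R ⧸ Ideal.span (Set.range f))) := by
  refine ⟨ker_koszulD_zero hreg.toIsWeaklyRegular,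
    fun p hp => ker_koszulD_succ hreg.toIsWeaklyRegular hp, ?_⟩
  rintro m rfl
  exact ⟨topKoszulCohomologyEquiv f⟩
end
end
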